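/- Let D be a DAG on a finite index set I with finite value types, and let p be a positive joint pmf that is Markov compatible with and faithful to D. Let X, Y ∈ I be distinct and W ⊆ I \ {X, Y} with causal ordering W < {X} < {Y} in D. Suppose there exist W ∈ W and Z ⊆ W \ {W} such that under p: (i) the variables W and Y are NOT conditionally independent given Z, and (ii) W and Y are conditionally independent given Z ∪ {X}. Then there is a directed path from X to Y in D with at least one edge, and Z is an adjustment set relative to ({X}, {Y}) in D. -/

import Mathlib

open scoped Classical

variable {V : Type*}

/-- `a` is an ancestor of `b` (every vertex is its own ancestor). -/
def Anc (E : V → V → Prop) (a b : V) : Prop := Relation.ReflTransGen E a b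

/-- A path in a directed graph `E` from `a` to `b`: a sequence of distinct vertices
`a = vtx 0, …, vtx len = b` (`len ≥ 1`) in which consecutive vertices are joined
by an edge of `E` in either direction. -/
structure GPath (E : V → V → Prop) (a b : V) where
  len : ℕ
  len_pos : 0 < len
  vtx : ℕ → V
  first : vtx 0 = a
  last : vtx len = b
  inj : ∀ i j, i ≤ len → j ≤ len → vtx i = vtx j → i = j
  adj : ∀ i, i < len → E (vtx i) (vtx (i + 1)) ∨ E (vtx (i + 1)) (vtx i)

namespace GPath

variable {E : V → V → Prop} {a b : V}

/-- The interior vertex at position `i` is a collider on the path. -/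
def IsColliderAt (p : GPath E a b) (i : ℕ) : Prop :=
  0 < i ∧ i < p.len ∧ E (p.vtx (i - 1)) (p.vtx i) ∧ E (p.vtx (i + 1)) (p.vtx i)

/-- A path is open given `S` if no non-collider on it lies in `S` and every collider
on it has a descendant in `S`. -/
def OpenGiven (p : GPath E a b) (S : Set V) : Prop :=
  (∀ i, 0 < i → i < p.len → ¬ p.IsColliderAt i → p.vtx i ∉ S) ∧
  (∀ i, p.IsColliderAt i → ∃ d ∈ S, Anc E (p.vtx i) d)

/-- A back-door path: the first edge points into the first vertex. -/
def IsBackdoor (p : GPath E a b) : Prop := E (p.vtx 1) (p.vtx 0)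

/-- A causal (directed) path. -/
def Causal (p : GPath E a b) : Prop := ∀ i, i < p.len → E (p.vtx i) (p.vtx (i + 1))

/-- A path is proper with respect to `X` if only its first vertex lies in `X`. -/
def ProperFrom (p : GPath E a b) (X : Set V) : Prop :=
  ∀ i, 0 < i → i ≤ p.len → p.vtx i ∉ X

/-- The vertex `w` lies on the path. -/
def MemV (p : GPath E a b) (w : V) : Prop := ∃ i ≤ p.len, p.vtx i = w

/-- The number of colliders on the path. -/
noncomputable def numColliders (p : GPath E a b) : ℕ := Set.ncard {i | p.IsColliderAt i}

end GPath

/-- `A` and `B` are d-separated given `S`: every path from `A` to `B` is blocked given `S`. -/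
def DSep (E : V → V → Prop) (A B S : Set V) : Prop :=
  ∀ a ∈ A, ∀ b ∈ B, ∀ p : GPath E a b, ¬ p.OpenGiven S

/-- `A` and `B` are d-connected given `S`: some path from `A` to `B` is open given `S`. -/
def DConn (E : V → V → Prop) (A B S : Set V) : Prop :=
  ∃ a ∈ A, ∃ b ∈ B, ∃ p : GPath E a b, p.OpenGiven S

/-- The set of descendants of a vertex set `S`. -/
def descendants (E : V → V → Prop) (S : Set V) : Set V := {d | ∃ s ∈ S, Anc E s d}

/-- `S` blocks every back-door path from `x` to `y`. -/
def BlocksBackdoor (E : V → V → Prop) (x y : V) (S : Set V) : Prop :=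
  ∀ p : GPath E x y, p.IsBackdoor → ¬ p.OpenGiven S

/-- The back-door criterion for `Z` relative to `(X, Y)`. -/
def BackdoorCriterion (E : V → V → Prop) (X Y Z : Set V) : Prop :=
  Z ∩ descendants E X = ∅ ∧
  ∀ x ∈ X, ∀ y ∈ Y, BlocksBackdoor E x y (Z ∪ (X \ {x}))

/-- The adjustment criterion for `Z` relative to `(X, Y)`: (a) `Z` contains no
descendant of any `w ∉ X` lying on a proper causal path from `X` to `Y`, and
(b) `Z` blocks every proper non-causal path from `X` to `Y`. -/
def AdjustmentCriterion (E : V → V → Prop) (X Y Z : Set V) : Prop :=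
  (∀ w, w ∉ X →
      (∃ x ∈ X, ∃ y ∈ Y, ∃ p : GPath E x y, p.ProperFrom X ∧ p.Causal ∧ p.MemV w) →
      ∀ z ∈ Z, ¬ Anc E w z) ∧
  (∀ x ∈ X, ∀ y ∈ Y, ∀ p : GPath E x y, p.ProperFrom X → ¬ p.Causal → ¬ p.OpenGiven Z)

variable {I : Type*} [Fintype I] {α : I → Type*} [∀ i, Fintype (α i)] [∀ i, Nonempty (α i)]

/-- The marginal probability, under the joint pmf `p`, that the coordinates in `S`
take the values `x` assigns them. -/
noncomputable def prS (p : (∀ i, α i) → ℝ) (S : Set I) (x : ∀ i, α i) : ℝ :=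
  ∑ᶠ v ∈ {v : ∀ i, α i | ∀ i ∈ S, v i = x i}, p v

/-- `p` is a joint probability mass function. -/
def IsPMF (p : (∀ i, α i) → ℝ) : Prop := (∀ v, 0 ≤ p v) ∧ ∑ᶠ v, p v = 1

/-- The conditional probability of the assignment `x` on `A` given its values on `S`. -/
noncomputable def condPr (p : (∀ i, α i) → ℝ) (A S : Set I) (x : ∀ i, α i) : ℝ :=
  prS p (A ∪ S) x / prS p S x

/-- Conditional independence `A ⫫ B | S` under `p`. -/
def CondIndep (p : (∀ i, α i) → ℝ) (A B S : Set I) : Prop :=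
  ∀ x : ∀ i, α i, condPr p (A ∪ B) S x = condPr p A S x * condPr p B S x

/-- `p` is Markov compatible with the DAG `E`: it factorizes along parents. -/
def MarkovCompat (p : (∀ i, α i) → ℝ) (E : I → I → Prop) : Prop :=
  ∀ v, p v = ∏ᶠ i, condPr p {i} {j | E j i} v

/-- `p` is faithful to `E`: conditional independence holds exactly for d-separations. -/
def Faithful (p : (∀ i, α i) → ℝ) (E : I → I → Prop) : Prop :=
  ∀ A B S : Set I, Disjoint A B → Disjoint S (A ∪ B) →
    (CondIndep p A B S ↔ DSep E A B S)

/-- The interventional pmf `p(v | do(x))` (the truncated factorization). -/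
noncomputable def doPMF (p : (∀ i, α i) → ℝ) (E : I → I → Prop) (X : Set I)
    (x v : ∀ i, α i) : ℝ :=
  if ∀ i ∈ X, v i = x i then ∏ᶠ i ∈ Xᶜ, condPr p {i} {j | E j i} v else 0

/-- Combine the assignment `x` on `X`, the partial assignment `z` on `Z`, and the
assignment `y` elsewhere into one full assignment. -/
noncomputable def mergeVals (X Z : Set I) (x : ∀ i, α i) (z : ∀ j : Z, α j.1)
    (y : ∀ i, α i) : ∀ i, α i :=
  fun i => if h : i ∈ Z then z ⟨i, h⟩ else if i ∈ X then x i else y i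

/-- `Z` is an adjustment set relative to `(X, Y)` in the DAG `E`: for every positive
pmf `q` that is Markov compatible with `E` and all value assignments `x`, `y`,
the interventional probability of `y` on `Y` under `do(x)` equals
`∑ z, q(y | x, z) · q(z)`. -/
def IsAdjustmentSet (E : I → I → Prop) (X Y Z : Set I) : Prop :=
  ∀ q : (∀ i, α i) → ℝ, IsPMF q → (∀ v, 0 < q v) → MarkovCompat q E →
    ∀ x y : ∀ i, α i,
      (∑ᶠ v ∈ {v : ∀ i, α i | ∀ i ∈ Y, v i = y i}, doPMF q E X x v) =
      ∑ᶠ z : (∀ j : Z, α j.1),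
        condPr q Y (X ∪ Z) (mergeVals X Z x z y) * prS q Z (mergeVals X Z x z y)

/-- `Z` is a minimal adjustment set relative to `(X, Y)`: it is an adjustment set
and no proper subset of it is. -/
def MinimalAdjustmentSet (E : I → I → Prop) (X Y Z : Set I) : Prop :=
  IsAdjustmentSet (α := α) E X Y Z ∧ ∀ Z', Z' ⊂ Z → ¬ IsAdjustmentSet (α := α) E X Y Z'

/-- `v` has a descendant in `S`. -/
def AnS (E : V → V → Prop) (S : Set V) (v : V) : Prop := ∃ d ∈ S, Anc E v d

/-- An open path given `S` as a sequence of vertices. -/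
structure OWalk (E : V → V → Prop) (S : Set V) (f : ℕ → V) (n : ℕ) : Prop where
  inj : ∀ i j, i ≤ n → j ≤ n → f i = f j → i = j
  adj : ∀ i, i < n → E (f i) (f (i + 1)) ∨ E (f (i + 1)) (f i)
  col : ∀ i, i + 1 < n → E (f i) (f (i + 1)) → E (f (i + 2)) (f (i + 1)) → AnS E S (f (i + 1))
  non : ∀ i, i + 1 < n → ¬ (E (f i) (f (i + 1)) ∧ E (f (i + 2)) (f (i + 1))) → f (i + 1) ∉ S

/-- Reachability from `w` by open walks given `S`. -/
inductive Reach (E : V → V → Prop) (S : Set V) (w : V) : Bool → V → Prop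
  | start : Reach E S w false w
  | upF {u v : V} : Reach E S w false v → v ∉ S → E u v → Reach E S w false u
  | upT {u v : V} : Reach E S w true v → AnS E S v → E u v → Reach E S w false u
  | down {d : Bool} {v c : V} : Reach E S w d v → v ∉ S → E v c → Reach E S w true c

lemma dag_asymm {E : V → V → Prop} (hdag : Irreflexive (Relation.TransGen E)) {a b : V}
    (h : E a b) : ¬ E b a := fun h' =>
  hdag a (Relation.TransGen.tail (Relation.TransGen.single h) h')

lemma dag_irrefl {E : V → V → Prop} (hdag : Irreflexive (Relation.TransGen E)) {a : V} :
    ¬ E a a := fun h => hdag a (Relation.TransGen.single h)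

lemma OWalk.restrict {E : V → V → Prop} {S : Set V} {f : ℕ → V} {n k : ℕ}
    (h : OWalk E S f n) (hk : k ≤ n) : OWalk E S f k where
  inj i j hi hj := h.inj i j (hi.trans hk) (hj.trans hk)
  adj i hi := h.adj i (by omega)
  col i hi := h.col i (by omega)
  non i hi := h.non i (by omega)

lemma AnS.of_anc {E : V → V → Prop} {S : Set V} {u v : V} (h : AnS E S v) (huv : Anc E u v) :
    AnS E S u := by
  obtain ⟨d, hd, hvd⟩ := h
  exact ⟨d, hd, Relation.ReflTransGen.trans huv hvd⟩

lemma OWalk.follow {E : V → V → Prop} (hdag : Irreflexive (Relation.TransGen E))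
    {S : Set V} {f : ℕ → V} {n : ℕ} (h : OWalk E S f n) :
    ∀ m k, k + m + 1 = n → E (f k) (f (k + 1)) →
      AnS E S (f k) ∨ (E (f (n - 1)) (f n) ∧ Anc E (f k) (f n)) := by
  intro m
  induction m with
  | zero =>
    intro k hk hE
    subst hk
    exact Or.inr ⟨by simpa using hE, Relation.ReflTransGen.single hE⟩
  | succ m ih =>
    intro k hk hE
    rcases h.adj (k + 1) (by omega) with h1 | h1
    · rcases ih (k + 1) (by omega) h1 with h2 | ⟨h2, h3⟩
      · exact Or.inl (h2.of_anc (Relation.ReflTransGen.single hE))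
      · exact Or.inr ⟨h2, Relation.ReflTransGen.head hE h3⟩
    · exact Or.inl ((h.col k (by omega) hE h1).of_anc (Relation.ReflTransGen.single hE))

lemma OWalk.followBack {E : V → V → Prop} 
    {S : Set V} {f : ℕ → V} {n : ℕ} (h : OWalk E S f n) :
    ∀ k, k < n → E (f (k + 1)) (f k) →
      AnS E S (f (k + 1)) ∨ Anc E (f (k + 1)) (f 0) := by
  intro k
  induction k with
  | zero =>
    intro hk hE
    exact Or.inr (Relation.ReflTransGen.single hE)
  | succ k ih =>
    intro hk hE
    rcases h.adj k (by omega) with h1 | h1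
    · exact Or.inl ((h.col k (by omega) h1 hE).of_anc (Relation.ReflTransGen.single hE))
    · rcases ih (by omega) h1 with h2 | h2
      · exact Or.inl (h2.of_anc (Relation.ReflTransGen.single hE))
      · exact Or.inr (Relation.ReflTransGen.head hE h2)

lemma OWalk.extend {E : V → V → Prop} {S : Set V} {f : ℕ → V} {n : ℕ} (h : OWalk E S f n)
    {u : V} (hadj : E (f n) u ∨ E u (f n)) (hnew : ∀ k, k ≤ n → f k ≠ u)
    (hcol : 0 < n → E (f (n - 1)) (f n) → E u (f n) → AnS E S (f n))
    (hnon : 0 < n → ¬ (E (f (n - 1)) (f n) ∧ E u (f n)) → f n ∉ S) :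
    OWalk E S (fun i => if i ≤ n then f i else u) (n + 1) := by
  refine ⟨?_, ?_, ?_, ?_⟩
  · intro i j hi hj hij
    by_cases h1 : i ≤ n <;> by_cases h2 : j ≤ n <;> simp only [h1, h2, if_true, if_false] at hij
    · exact h.inj i j h1 h2 hij
    · exact absurd hij (hnew i h1)
    · exact absurd hij.symm (hnew j h2)
    · omega
  · intro i hi
    by_cases h1 : i = n
    · subst h1; simpa using hadj
    · have h2 : i + 1 ≤ n := by omega
      have h3 : i ≤ n := by omega
      simpa [h2, h3] using h.adj i (by omega)
  · intro i hi
    have h2 : i + 1 ≤ n := by omega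
    have h3 : i ≤ n := by omega
    by_cases h1 : i + 1 = n
    · subst h1; simpa using hcol (by omega)
    · have h4 : i + 2 ≤ n := by omega
      simpa [h2, h3, h4] using h.col i (by omega)
  · intro i hi
    have h2 : i + 1 ≤ n := by omega
    have h3 : i ≤ n := by omega
    by_cases h1 : i + 1 = n
    · subst h1; simpa using hnon (by omega)
    · have h4 : i + 2 ≤ n := by omega
      simpa [h2, h3, h4] using h.non i (by omega)

/-- Compatibility of the end of a path with a reachability state. -/
def Compat (E : V → V → Prop) (S : Set V) (f : ℕ → V) (n : ℕ) : Bool → Prop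
  | true => (0 < n ∧ E (f (n - 1)) (f n)) ∨ f n ∉ S
  | false => (0 < n ∧ E (f (n - 1)) (f n)) → AnS E S (f n)

lemma OWalk.up {E : V → V → Prop} (hdag : Irreflexive (Relation.TransGen E)) {S : Set V}
    {w u v : V} {f : ℕ → V} {n : ℕ} (h : OWalk E S f n) (h0 : f 0 = w) (hn : f n = v)
    (hE : E u v) (hin : (0 < n ∧ E (f (n - 1)) (f n)) → AnS E S v)
    (hout : ¬ (0 < n ∧ E (f (n - 1)) (f n)) → v ∉ S) :
    ∃ f n, f 0 = w ∧ f n = u ∧ OWalk E S f n ∧ Compat E S f n false := by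
  subst hn
  by_cases hex : ∃ k, k ≤ n ∧ f k = u
  · obtain ⟨k, hk, rfl⟩ := hex
    have hkn : k ≠ n := by rintro rfl; exact dag_irrefl hdag hE
    refine ⟨f, k, h0, rfl, h.restrict hk, ?_⟩
    rintro ⟨hk0, hEk⟩
    obtain ⟨k, rfl⟩ : ∃ j, k = j + 1 := ⟨k - 1, by omega⟩
    simp only [Nat.add_sub_cancel] at hEk
    rcases h.adj (k + 1) (by omega) with h1 | h1
    · rcases h.follow hdag (n - (k + 1) - 1) (k + 1) (by omega) h1 with h2 | ⟨h2, h3⟩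
      · exact h2
      · exact (hin ⟨by omega, h2⟩).of_anc h3
    · exact h.col k (by omega) hEk h1
  · push Not at hex
    refine ⟨_, n + 1, ?_, ?_, h.extend (u := u) (Or.inr hE) hex ?_ ?_, ?_⟩
    · simpa using h0
    · simp
    · intro hn h1 _; exact hin ⟨hn, h1⟩
    · intro hn h1; exact hout fun h2 => h1 ⟨h2.2, hE⟩
    · rintro ⟨_, h1⟩
      simp only [Nat.add_sub_cancel, le_refl, if_true] at h1
      exact absurd hE (by simpa using dag_asymm hdag h1)

lemma Reach.toWalk {E : V → V → Prop} (hdag : Irreflexive (Relation.TransGen E)) {S : Set V}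
    {w : V} (hw : w ∉ S) {d : Bool} {v : V} (h : Reach E S w d v) :
    ∃ f n, f 0 = w ∧ f n = v ∧ OWalk E S f n ∧ Compat E S f n d := by
  induction h with
  | start =>
    refine ⟨fun _ => w, 0, rfl, rfl, ⟨?_, ?_, ?_, ?_⟩, ?_⟩
    · intros; omega
    · intros; omega
    · intros; omega
    · intros; omega
    · rintro ⟨h, _⟩; omega
  | upF _ hv hE ih =>
    obtain ⟨f, n, h0, hn, hf, hc⟩ := ih
    refine hf.up hdag h0 hn hE ?_ (fun _ => hv)
    rw [← hn]; exact hc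
  | upT _ hv hE ih =>
    obtain ⟨f, n, h0, hn, hf, hc⟩ := ih
    refine hf.up hdag h0 hn hE (fun _ => hv) ?_
    intro h1
    rw [← hn]; exact hc.resolve_left h1
  | @down d v c _ hv hE ih =>
    obtain ⟨f, n, h0, hn, hf, -⟩ := ih
    subst hn
    by_cases hex : ∃ k, k ≤ n ∧ f k = c
    · obtain ⟨k, hk, rfl⟩ := hex
      have hkn : k ≠ n := by rintro rfl; exact dag_irrefl hdag hE
      refine ⟨f, k, h0, rfl, hf.restrict hk, ?_⟩
      show (0 < k ∧ E (f (k - 1)) (f k)) ∨ f k ∉ S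
      by_cases hk0 : k = 0
      · subst hk0; right; rwa [h0]
      obtain ⟨k, rfl⟩ : ∃ j, k = j + 1 := ⟨k - 1, by omega⟩
      by_cases hcol : E (f k) (f (k + 1)) ∧ E (f (k + 2)) (f (k + 1))
      · exact Or.inl ⟨by omega, by simpa using hcol.1⟩
      · exact Or.inr (hf.non k (by omega) hcol)
    · push Not at hex
      refine ⟨_, n + 1, ?_, ?_, hf.extend (u := c) (Or.inl hE) hex ?_ ?_, ?_⟩
      · simpa using h0
      · simp
      · intro _ _ h2; exact absurd h2 (dag_asymm hdag hE)
      · intro _ _; exact hv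
      · left; exact ⟨by omega, by simpa using hE⟩

lemma Reach.not_dsep {E : V → V → Prop} (hdag : Irreflexive (Relation.TransGen E)) {S : Set V}
    {w y : V} (hw : w ∉ S) (hwy : w ≠ y) {d : Bool} (h : Reach E S w d y) :
    ¬ DSep E {w} {y} S := by
  obtain ⟨f, n, h0, hn, hf, -⟩ := h.toWalk hdag hw
  intro hd
  have hn0 : 0 < n := by
    rcases Nat.eq_zero_or_pos n with rfl | h1
    · exact absurd (h0.symm.trans hn) hwy
    · exact h1
  refine hd w rfl y rfl ⟨n, hn0, f, h0, hn, hf.inj, hf.adj⟩ ⟨?_, ?_⟩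
  · intro i hi hin hnc
    obtain ⟨i, rfl⟩ : ∃ j, i = j + 1 := ⟨i - 1, by omega⟩
    exact hf.non i hin fun h => hnc ⟨by omega, hin, by simpa using h.1, h.2⟩
  · rintro i ⟨hi, hin, h1, h2⟩
    obtain ⟨i, rfl⟩ : ∃ j, i = j + 1 := ⟨i - 1, by omega⟩
    exact hf.col i hin (by simpa using h1) h2

lemma GPath.toWalk {E : V → V → Prop} {S : Set V} {a b : V} (P : GPath E a b)
    (hP : P.OpenGiven S) : OWalk E S P.vtx P.len where
  inj := P.inj
  adj := P.adj
  col i hi h1 h2 := hP.2 (i + 1) ⟨by omega, hi, by simpa using h1, h2⟩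
  non i hi h := hP.1 (i + 1) (by omega) hi fun hc => h ⟨by simpa using hc.2.2.1, hc.2.2.2⟩

/-- The graphical core: there is a directed path from `X` to `Y`, and `X` is reached
with an arrow into it. -/
lemma graph_core {E : V → V → Prop} (hdag : Irreflexive (Relation.TransGen E))
    {X Y W0 : V} {Z : Set V} (hXY : X ≠ Y) (hWX : ¬ Anc E X W0)
    (hZX : ¬ AnS E Z X) (hWZ : W0 ∉ Z)
    (hconn : ¬ DSep E {W0} {Y} Z) (hsep : DSep E {W0} {Y} (Z ∪ {X})) :
    Relation.TransGen E X Y ∧ Reach E (Z ∪ {X}) W0 true X := by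
  unfold DSep at hconn
  push Not at hconn
  obtain ⟨a, rfl, b, rfl, P, hP⟩ := hconn
  have hf := P.toWalk hP
  have hnot := hsep a rfl b rfl P
  have hk : ∃ k, k + 1 < P.len ∧ P.vtx (k + 1) = X ∧
      ¬ (E (P.vtx k) (P.vtx (k + 1)) ∧ E (P.vtx (k + 2)) (P.vtx (k + 1))) := by
    by_contra hne
    push Not at hne
    apply hnot
    refine ⟨?_, ?_⟩
    · intro i hi hin hnc hmem
      obtain ⟨i, rfl⟩ : ∃ j, i = j + 1 := ⟨i - 1, by omega⟩
      rcases hmem with hmem | hmem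
      · exact hP.1 _ hi hin hnc hmem
      · have := hne i hin hmem
        exact hnc ⟨hi, hin, by simpa using this.1, this.2⟩
    · intro i hi
      obtain ⟨d, hd, h⟩ := hP.2 i hi
      exact ⟨d, Or.inl hd, h⟩
  obtain ⟨k, hkl, hkX, hnc⟩ := hk
  have hin : E (P.vtx k) (P.vtx (k + 1)) := by
    rcases hf.adj k (by omega) with h | h
    · exact h
    · exfalso
      rcases hf.followBack k (by omega) h with h1 | h1
      · rw [hkX] at h1; exact hZX h1
      · rw [hkX, P.first] at h1; exact hWX h1
  have hout : E (P.vtx (k + 1)) (P.vtx (k + 2)) :=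
    (hf.adj (k + 1) hkl).resolve_right fun h => hnc ⟨hin, h⟩
  constructor
  · rcases hf.follow hdag (P.len - (k + 1) - 1) (k + 1) (by omega) hout with h1 | ⟨_, h1⟩
    · rw [hkX] at h1; exact absurd h1 hZX
    · rw [hkX, P.last] at h1
      rcases Relation.reflTransGen_iff_eq_or_transGen.1 h1 with h2 | h2
      · exact absurd h2.symm hXY
      · exact h2
  · have hmem : ∀ j, j ≤ k → P.vtx j ∉ ({X} : Set V) := by
      intro j hj h
      have h' : P.vtx j = X := h
      have := P.inj j (k + 1) (by omega) (by omega) (h'.trans hkX.symm)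
      omega
    have hreach : ∀ j, j ≤ k → (E (P.vtx j) (P.vtx (j + 1)) → Reach E (Z ∪ {X}) a true (P.vtx (j + 1))) ∧
        (E (P.vtx (j + 1)) (P.vtx j) → Reach E (Z ∪ {X}) a false (P.vtx (j + 1))) := by
      intro j
      induction j with
      | zero =>
        intro hj
        have hs : Reach E (Z ∪ {X}) a false (P.vtx 0) := by rw [P.first]; exact Reach.start
        have h0 : P.vtx 0 ∉ Z ∪ {X} := by
          rintro (h | h)
          · rw [P.first] at h; exact hWZ h
          · exact hmem 0 hj h
        exact ⟨fun h => hs.down h0 h, fun h => hs.upF h0 h⟩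
      | succ j ih =>
        intro hj
        obtain ⟨ih1, ih2⟩ := ih (by omega)
        have hnm : ¬ (E (P.vtx j) (P.vtx (j + 1)) ∧ E (P.vtx (j + 2)) (P.vtx (j + 1))) →
            P.vtx (j + 1) ∉ Z ∪ {X} := by
          intro h
          rintro (h1 | h1)
          · exact hf.non j (by omega) h h1
          · exact hmem _ hj h1
        rcases hf.adj j (by omega) with h | h
        · refine ⟨fun h1 => (ih1 h).down (hnm fun h2 => dag_asymm hdag h1 h2.2) h1, fun h1 => ?_⟩
          obtain ⟨d, hd, h2⟩ := hf.col j (by omega) h h1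
          exact (ih1 h).upT ⟨d, Or.inl hd, h2⟩ h1
        · have h3 := hnm fun h2 => dag_asymm hdag h h2.1
          exact ⟨fun h1 => (ih2 h).down h3 h1, fun h1 => (ih2 h).upF h3 h1⟩
    have := (hreach k le_rfl).1 hin
    rwa [hkX] at this

/-- Descending along a directed path that avoids `S`. -/
lemma Reach.descend {E : V → V → Prop} {S : Set V} {w v y : V} {d : Bool}
    (h : Reach E S w d v) (hv : ¬ AnS E S v) (hvy : Anc E v y) : ∃ d, Reach E S w d y := by
  unfold Anc at hvy
  induction hvy with
  | refl => exact ⟨d, h⟩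
  | @tail b c hvb hbc ih =>
    obtain ⟨d', h'⟩ := ih
    exact ⟨true, h'.down (fun hb => hv ⟨b, hb, hvb⟩) hbc⟩

/-- The set separating the families. -/
lemma family_split {E : V → V → Prop} (hdag : Irreflexive (Relation.TransGen E))
    {X Y W0 : V} {Z : Set V} (hXY : X ≠ Y) (hWY : W0 ≠ Y) (hWZ : W0 ∉ Z) (hWX : W0 ≠ X)
    (hsep : DSep E {W0} {Y} (Z ∪ {X})) (hX : Reach E (Z ∪ {X}) W0 true X) :
    ∃ U : Set V, X ∈ U ∧ Y ∉ U ∧ (∀ j, E j X → j ∈ U ∪ Z) ∧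
      ∀ i, (AnS E (Z ∪ {X}) i ∨ Anc E i Y) → i ≠ X →
        ((i ∈ U ∪ Z ∧ ∀ j, j ≠ X → E j i → j ∈ U ∪ Z) ∨
          (i ∉ U ∧ ∀ j, j ≠ X → E j i → j ∉ U)) := by
  have hno : ∀ d, ¬ Reach E (Z ∪ {X}) W0 d Y := fun d h =>
    h.not_dsep hdag (by rintro (h | h); exacts [hWZ h, hWX h]) hWY hsep
  set S := Z ∪ {X} with hS
  refine ⟨{v | v = X ∨ (v ∉ S ∧ ∃ d, Reach E S W0 d v)}, Or.inl rfl, ?_, ?_, ?_⟩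
  · rintro (h | ⟨-, d, h⟩)
    · exact hXY h.symm
    · exact hno d h
  · intro j hj
    by_cases h : j ∈ Z
    · exact Or.inr h
    · refine Or.inl (Or.inr ⟨?_, false, hX.upT ⟨X, Or.inr rfl, Relation.ReflTransGen.refl⟩ hj⟩)
      rintro (h1 | h1)
      · exact h h1
      · have h1 : j = X := h1
        subst h1; exact dag_irrefl hdag hj
  · intro i hi hiX
    -- all the parents are reached as soon as i is
    have key : ∀ d, Reach E S W0 d i → (i ∈ S ∨ i ∉ S) → (d = true ∨ i ∉ S) →
        ∀ j, E j i → Reach E S W0 false j := by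
      intro d hd _ hor j hj
      by_cases hA : AnS E S i
      · cases d with
        | true => exact hd.upT hA hj
        | false => exact hd.upF (hor.resolve_left (by simp)) hj
      · exfalso
        obtain ⟨d', h'⟩ := hd.descend hA (hi.resolve_left hA)
        exact hno d' h'
    have fin : ∀ d, Reach E S W0 d i → (d = true ∨ i ∉ S) →
        (i ∈ {v | v = X ∨ (v ∉ S ∧ ∃ d, Reach E S W0 d v)} ∪ Z ∧
          ∀ j, j ≠ X → E j i → j ∈ {v | v = X ∨ (v ∉ S ∧ ∃ d, Reach E S W0 d v)} ∪ Z) := by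
      intro d hd hor
      constructor
      · by_cases h : i ∈ Z
        · exact Or.inr h
        · exact Or.inl (Or.inr ⟨by rintro (h1 | h1); exacts [h h1, hiX h1], d, hd⟩)
      · intro j hjX hj
        by_cases h : j ∈ Z
        · exact Or.inr h
        · exact Or.inl (Or.inr ⟨by rintro (h1 | h1); exacts [h h1, hjX h1], false,
            key d hd (em _) hor j hj⟩)
    by_cases h1 : i ∉ S ∧ ∃ d, Reach E S W0 d i
    · obtain ⟨h2, d, hd⟩ := h1
      exact Or.inl (fin d hd (Or.inr h2))
    · by_cases h2 : ∃ j, j ≠ X ∧ E j i ∧ (j ∉ S ∧ ∃ d, Reach E S W0 d j)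
      · obtain ⟨j, hjX, hj, hjS, d, hd⟩ := h2
        exact Or.inl (fin true (hd.down hjS hj) (Or.inl rfl))
      · right
        constructor
        · rintro (h | h)
          · exact hiX h
          · exact h1 h
        · rintro j hjX hj (h | h)
          · exact hjX h
          · exact h2 ⟨j, hjX, hj, h⟩

/-- Indicator that `v` matches `x` on `S`. -/
noncomputable def matchInd (S : Set I) (x v : ∀ i, α i) : ℝ := if ∀ i ∈ S, v i = x i then 1 else 0

lemma prS_eq (p : (∀ i, α i) → ℝ) (S : Set I) (x : ∀ i, α i) :
    prS p S x = ∑ v, matchInd S x v * p v := by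
  unfold prS matchInd
  rw [finsum_mem_def, finsum_eq_sum_of_fintype]
  refine Finset.sum_congr rfl fun v _ => ?_
  by_cases h : ∀ i ∈ S, v i = x i <;> simp [Set.indicator, h]

lemma matchInd_congr {S : Set I} {x x' v v' : ∀ i, α i} (h : ∀ i ∈ S, x i = x' i)
    (h' : ∀ i ∈ S, v i = v' i) : matchInd S x v = matchInd S x' v' := by
  unfold matchInd
  have : (∀ i ∈ S, v i = x i) ↔ (∀ i ∈ S, v' i = x' i) :=
    forall₂_congr fun i hi => by rw [h i hi, h' i hi]
  simp only [this]

lemma matchInd_union (S T : Set I) (x v : ∀ i, α i) : matchInd (S ∪ T) x v = matchInd S x v * matchInd T x v := by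
  unfold matchInd
  have : (∀ i ∈ S ∪ T, v i = x i) ↔ (∀ i ∈ S, v i = x i) ∧ (∀ i ∈ T, v i = x i) := by
    simp only [Set.mem_union, or_imp, forall_and]
  simp only [this, ite_and, mul_ite, mul_one, mul_zero]
  split_ifs <;> rfl

lemma matchInd_single (i : I) (x v : ∀ i, α i) : matchInd {i} x v = if v i = x i then 1 else 0 := by
  simp [matchInd]

lemma prS_congr (p : (∀ i, α i) → ℝ) {S : Set I} {x x' : ∀ i, α i}
    (h : ∀ i ∈ S, x i = x' i) : prS p S x = prS p S x' := by
  rw [prS_eq, prS_eq]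
  exact Finset.sum_congr rfl fun v _ => by rw [matchInd_congr h fun _ _ => rfl]

lemma prS_pos (p : (∀ i, α i) → ℝ) (hp : ∀ v, 0 < p v) (S : Set I) (x : ∀ i, α i) :
    0 < prS p S x := by
  rw [prS_eq]
  refine Finset.sum_pos' (fun v _ => ?_) ⟨x, Finset.mem_univ _, ?_⟩
  · refine mul_nonneg ?_ (hp v).le
    unfold matchInd; split_ifs <;> norm_num
  · simpa [matchInd] using hp x

lemma condPr_congr (p : (∀ i, α i) → ℝ) {A S : Set I} {x x' : ∀ i, α i}
    (hA : ∀ i ∈ A, x i = x' i) (h : ∀ i ∈ S, x i = x' i) : condPr p A S x = condPr p A S x' := by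
  unfold condPr
  rw [prS_congr p h, prS_congr p (S := A ∪ S)]
  rintro i (hi | hi)
  exacts [hA i hi, h i hi]

lemma condPr_norm (p : (∀ i, α i) → ℝ) (hp : ∀ v, 0 < p v) {i : I} {S : Set I} (hi : i ∉ S)
    (v : ∀ i, α i) : ∑ a, condPr p {i} S (Function.update v i a) = 1 := by
  have h1 : ∀ a, prS p S (Function.update v i a) = prS p S v := fun a =>
    prS_congr p fun j hj => Function.update_of_ne (by rintro rfl; exact hi hj) _ _
  unfold condPr
  simp only [h1]
  rw [← Finset.sum_div, div_eq_one_iff_eq (prS_pos p hp S v).ne']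
  simp only [prS_eq]
  rw [Finset.sum_comm]
  refine Finset.sum_congr rfl fun w _ => ?_
  rw [← Finset.sum_mul]
  congr 1
  have h2 : ∀ a, matchInd S (Function.update v i a) w = matchInd S v w := fun a =>
    matchInd_congr (fun j hj => Function.update_of_ne (by rintro rfl; exact hi hj) _ _) fun _ _ => rfl
  simp only [matchInd_union, matchInd_single, h2, Function.update_self]
  rw [← Finset.sum_mul]
  simp

lemma fiber_sum (F : (∀ i, α i) → ℝ) (s : I) (x : α s) :
    ∑ v, F v = ∑ v, (if v s = x then ∑ a, F (Function.update v s a) else 0) := by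
  have : ∀ v : ∀ i, α i, (if v s = x then ∑ a, F (Function.update v s a) else 0)
      = ∑ a, if v s = x then F (Function.update v s a) else 0 := by
    intro v; split_ifs <;> simp
  simp only [this]
  rw [← Finset.sum_product', ← Finset.sum_filter]
  refine Finset.sum_bij' (fun v _ => (Function.update v s x, v s))
    (fun w _ => Function.update w.1 s w.2) ?_ ?_ ?_ ?_ ?_
  · intro v _; simp
  · intro w _; simp
  · intro v _; simp
  · rintro ⟨w, a⟩ hw
    simp at hw
    subst hw
    simp
  · intro v _; simp

lemma sum_step (ψ k : (∀ i, α i) → ℝ) (s : I)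
    (hψ : ∀ v a, ψ (Function.update v s a) = ψ v)
    (hk : ∀ v, ∑ a, k (Function.update v s a) = 1) :
    (∑ v, ψ v * k v) * (Fintype.card (α s) : ℝ) = ∑ v, ψ v := by
  have h : ∀ x : α s, ∑ v, ψ v * k v = ∑ v : (∀ i, α i), if v s = x then ψ v else 0 := by
    intro x
    rw [fiber_sum _ s x]
    refine Finset.sum_congr rfl fun v _ => ?_
    simp only [hψ, ← Finset.mul_sum, hk, mul_one]
  have h2 : ∑ _x : α s, (∑ v, ψ v * k v) = ∑ v, ψ v := by
    rw [Finset.sum_congr rfl fun x _ => h x, Finset.sum_comm]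
    simp
  rw [← h2]
  simp [mul_comm]

lemma exists_sink (E : I → I → Prop) (hdag : Irreflexive (Relation.TransGen E)) (C : Finset I)
    (hC : C.Nonempty) : ∃ s ∈ C, ∀ c ∈ C, ¬ E s c := by
  let r : I → I → Prop := fun a b => Relation.TransGen E b a
  have : IsTrans I r := ⟨fun a b c h1 h2 => Relation.TransGen.trans h2 h1⟩
  have : Std.Irrefl r := ⟨fun a => hdag a⟩
  have hwf : WellFounded r := Finite.wellFounded_of_trans_of_irrefl r
  obtain ⟨s, hs, hm⟩ := hwf.has_min (C : Set I) hC
  exact ⟨s, hs, fun c hc h => hm c hc (Relation.TransGen.single h)⟩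

lemma marg_aux (E : I → I → Prop) (hdag : Irreflexive (Relation.TransGen E))
    (k : I → (∀ i, α i) → ℝ)
    (hk : ∀ i v v', v i = v' i → (∀ j, E j i → v j = v' j) → k i v = k i v')
    (hn : ∀ i v, ∑ a, k i (Function.update v i a) = 1)
    (A : Finset I) (hA : ∀ i ∈ A, ∀ j, E j i → j ∈ A) (φ : (∀ i, α i) → ℝ)
    (hφ : ∀ v v', (∀ i ∈ A, v i = v' i) → φ v = φ v') :
    ∀ (n : ℕ) (C : Finset I), C.card = n → Disjoint A C →
      (∀ i ∈ C, ∀ j, E j i → j ∈ A ∪ C) →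
      (∑ v, φ v * ∏ i ∈ A ∪ C, k i v) * ∏ i ∈ C, (Fintype.card (α i) : ℝ)
        = ∑ v, φ v * ∏ i ∈ A, k i v := by
  intro n
  induction n with
  | zero =>
    intro C hC _ _
    rw [Finset.card_eq_zero] at hC
    subst hC
    simp
  | succ n ih =>
    intro C hC hd hp
    obtain ⟨s, hs, hsink⟩ := exists_sink E hdag C (Finset.card_pos.1 (by omega))
    have hsA : s ∉ A := fun h => (Finset.disjoint_left.1 hd h hs)
    have hC' : (C.erase s).card = n := by rw [Finset.card_erase_of_mem hs]; omega
    have ih' := ih (C.erase s) hC' (hd.mono_right (Finset.erase_subset _ _)) (by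
      intro i hi j hj
      have h1 := hp i (Finset.mem_of_mem_erase hi) j hj
      have h2 : j ≠ s := by rintro rfl; exact hsink i (Finset.mem_of_mem_erase hi) hj
      simp only [Finset.mem_union, Finset.mem_erase] at h1 ⊢
      tauto)
    have hnot : s ∉ A ∪ C.erase s := by simp [hsA]
    have hins : A ∪ C = insert s (A ∪ C.erase s) := by
      rw [← Finset.union_insert, Finset.insert_erase hs]
    rw [← ih', ← Finset.mul_prod_erase C _ hs, ← mul_assoc]
    congr 1
    rw [← sum_step (fun v => φ v * ∏ i ∈ A ∪ C.erase s, k i v) (k s) s ?_ (hn s)]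
    · congr 1
      refine Finset.sum_congr rfl fun v _ => ?_
      rw [hins, Finset.prod_insert hnot]
      ring
    · intro v a
      have e1 : φ (Function.update v s a) = φ v := hφ _ _ fun i hi =>
        Function.update_of_ne (by rintro rfl; exact hsA hi) _ _
      have e2 : ∏ i ∈ A ∪ C.erase s, k i (Function.update v s a)
          = ∏ i ∈ A ∪ C.erase s, k i v := by
        refine Finset.prod_congr rfl fun i hi => hk i _ _ ?_ ?_
        · exact Function.update_of_ne (by rintro rfl; exact hnot hi) _ _
        · intro j hj
          refine Function.update_of_ne ?_ _ _
          rintro rfl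
          rcases Finset.mem_union.1 hi with h | h
          · exact hsA (hA i h _ hj)
          · exact hsink i (Finset.mem_of_mem_erase h) hj
      simp only [e1, e2]

lemma marg (E : I → I → Prop) (hdag : Irreflexive (Relation.TransGen E))
    (k : I → (∀ i, α i) → ℝ)
    (hk : ∀ i v v', v i = v' i → (∀ j, E j i → v j = v' j) → k i v = k i v')
    (hn : ∀ i v, ∑ a, k i (Function.update v i a) = 1)
    (A : Finset I) (hA : ∀ i ∈ A, ∀ j, E j i → j ∈ A) (φ : (∀ i, α i) → ℝ)
    (hφ : ∀ v v', (∀ i ∈ A, v i = v' i) → φ v = φ v') :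
    (∑ v, φ v * ∏ i, k i v) * ∏ i ∈ Aᶜ, (Fintype.card (α i) : ℝ)
        = ∑ v, φ v * ∏ i ∈ A, k i v := by
  have := marg_aux E hdag k hk hn A hA φ hφ _ Aᶜ rfl disjoint_compl_right
    (by intro i _ j _; simp)
  simpa using this

lemma card_prod_ne (A : Finset I) : (∏ i ∈ A, (Fintype.card (α i) : ℝ)) ≠ 0 :=
  Finset.prod_ne_zero_iff.2 fun i _ => by
    have : 0 < Fintype.card (α i) := Fintype.card_pos
    positivity

/-- The swapping argument for conditional independence. -/
lemma swap_ci (U Z : Set I) (X Y : I) (hX : X ∈ U) (hY : Y ∉ U) (A : Finset I)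
    (h : I → (∀ i, α i) → ℝ) (D : I → Set I)
    (hdep : ∀ i ∈ A, ∀ v v', (∀ j ∈ D i, v j = v' j) → h i v = h i v')
    (hD : ∀ i ∈ A, D i ⊆ U ∪ Z ∨ Disjoint (D i) U) (x : ∀ i, α i) :
    (∑ v, matchInd ({Y} ∪ ({X} ∪ Z)) x v * ∏ i ∈ A, h i v) * (∑ v, matchInd Z x v * ∏ i ∈ A, h i v)
    = (∑ v, matchInd ({Y} ∪ Z) x v * ∏ i ∈ A, h i v) * (∑ v, matchInd ({X} ∪ Z) x v * ∏ i ∈ A, h i v) := by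
  let m : (∀ i, α i) → (∀ i, α i) → (∀ i, α i) := fun v w i => if i ∈ U then v i else w i
  rw [Finset.sum_mul_sum, Finset.sum_mul_sum, ← Finset.sum_product', ← Finset.sum_product']
  refine Finset.sum_bij' (fun w _ => (m w.2 w.1, m w.1 w.2)) (fun w _ => (m w.2 w.1, m w.1 w.2))
    ?_ ?_ ?_ ?_ ?_
  · intro w _; simp
  · intro w _; simp
  · rintro ⟨v, w⟩ _
    ext i <;> simp only [m] <;> split_ifs <;> rfl
  · rintro ⟨v, w⟩ _
    ext i <;> simp only [m] <;> split_ifs <;> rfl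
  · rintro ⟨v, w⟩ _
    simp only [matchInd_union, matchInd_single]
    have e1 : m w v Y = v Y := by simp [m, hY]
    have e2 : m v w X = v X := by simp [m, hX]
    rw [e1, e2]
    have e3 : matchInd Z x (m w v) * matchInd Z x (m v w) = matchInd Z x v * matchInd Z x w := by
      have : ((∀ i ∈ Z, m w v i = x i) ∧ (∀ i ∈ Z, m v w i = x i)) ↔
          ((∀ i ∈ Z, v i = x i) ∧ (∀ i ∈ Z, w i = x i)) := by
        rw [← forall₂_and, ← forall₂_and]
        refine forall₂_congr fun i hi => ?_
        simp only [m]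
        split_ifs <;> tauto
      unfold matchInd
      rw [ite_zero_mul_ite_zero, ite_zero_mul_ite_zero]
      simp only [this]
    by_cases hZv : ∀ i ∈ Z, v i = x i
    · by_cases hZw : ∀ i ∈ Z, w i = x i
      · have e4 : (∏ i ∈ A, h i v) * (∏ i ∈ A, h i w)
            = (∏ i ∈ A, h i (m w v)) * (∏ i ∈ A, h i (m v w)) := by
          rw [← Finset.prod_mul_distrib, ← Finset.prod_mul_distrib]
          refine Finset.prod_congr rfl fun i hi => ?_
          rcases hD i hi with hs | hs
          · rw [hdep i hi (m w v) w, hdep i hi (m v w) v, mul_comm]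
            · intro j hj
              simp only [m]
              split_ifs with hU
              · rfl
              · have := (hs hj).resolve_left hU
                rw [hZv j this, hZw j this]
            · intro j hj
              simp only [m]
              split_ifs with hU
              · rfl
              · have := (hs hj).resolve_left hU
                rw [hZv j this, hZw j this]
          · rw [hdep i hi (m w v) v, hdep i hi (m v w) w]
            · intro j hj
              simp [m, Set.disjoint_left.1 hs hj]
            · intro j hj
              simp [m, Set.disjoint_left.1 hs hj]
        calc _ = (if v Y = x Y then (1:ℝ) else 0) * (if v X = x X then 1 else 0)
              * (matchInd Z x v * matchInd Z x w) * ((∏ i ∈ A, h i v) * (∏ i ∈ A, h i w)) := by ring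
          _ = _ := by rw [e4, ← e3]; ring
      · have : matchInd Z x w = 0 := by simp only [matchInd, hZw, if_false]
        rw [this, mul_zero] at e3
        rw [this]
        calc _ = (0:ℝ) := by ring
          _ = (if v Y = x Y then (1:ℝ) else 0) * (if v X = x X then 1 else 0)
              * (matchInd Z x (m w v) * matchInd Z x (m v w)) *
              ((∏ i ∈ A, h i (m w v)) * (∏ i ∈ A, h i (m v w))) := by rw [e3]; ring
          _ = _ := by ring
    · have : matchInd Z x v = 0 := by simp only [matchInd, hZv, if_false]
      rw [this, zero_mul] at e3
      rw [this]
      calc _ = (0:ℝ) := by ring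
        _ = (if v Y = x Y then (1:ℝ) else 0) * (if v X = x X then 1 else 0)
            * (matchInd Z x (m w v) * matchInd Z x (m v w)) *
            ((∏ i ∈ A, h i (m w v)) * (∏ i ∈ A, h i (m v w))) := by rw [e3]; ring
        _ = _ := by ring

lemma adjust (E : I → I → Prop) (hdag : Irreflexive (Relation.TransGen E))
    (X Y : I) (hXY : X ≠ Y) (Z : Set I) (hYZ : Y ∉ Z) (hXZ : X ∉ Z) (hZX : ¬ AnS E Z X)
    (U : Set I) (hXU : X ∈ U) (hYU : Y ∉ U) (hpaX : ∀ j, E j X → j ∈ U ∪ Z)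
    (hfam : ∀ i, (AnS E (Z ∪ {X}) i ∨ Anc E i Y) → i ≠ X →
        ((i ∈ U ∪ Z ∧ ∀ j, j ≠ X → E j i → j ∈ U ∪ Z) ∨
          (i ∉ U ∧ ∀ j, j ≠ X → E j i → j ∉ U))) :
    IsAdjustmentSet (α := α) E {X} {Y} Z := by
  intro q _ hq hM x y
  set f : I → (∀ i, α i) → ℝ := fun i => condPr q {i} {j | E j i} with hf
  set h : I → (∀ i, α i) → ℝ := fun i v =>
    if i = X then f X v else f i (Function.update v X (x X)) with hh
  set g : (∀ i, α i) → ℝ := fun v => ∏ i, h i v with hg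
  have hqf : ∀ v, q v = ∏ i, f i v := fun v => by rw [hM v, finprod_eq_prod_of_fintype]
  have fdep : ∀ i v v', v i = v' i → (∀ j, E j i → v j = v' j) → f i v = f i v' := by
    intro i v v' h1 h2
    refine condPr_congr q ?_ h2
    rintro j rfl; exact h1
  have fnorm : ∀ i v, ∑ a, f i (Function.update v i a) = 1 := fun i v =>
    condPr_norm q hq (i := i) (S := {j | E j i}) (fun h => dag_irrefl hdag h) v
  have hdep0 : ∀ i v v', (∀ j ∈ {j | j = i ∨ (E j i ∧ (i = X ∨ j ≠ X))}, v j = v' j) →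
      h i v = h i v' := by
    intro i v v' h1
    simp only [hh]
    split_ifs with hi
    · subst hi
      exact fdep _ _ _ (h1 _ (Or.inl rfl)) fun j hj => h1 j (Or.inr ⟨hj, Or.inl rfl⟩)
    · refine fdep _ _ _ ?_ ?_
      · rw [Function.update_of_ne hi, Function.update_of_ne hi]
        exact h1 _ (Or.inl rfl)
      · intro j hj
        by_cases hjX : j = X
        · subst hjX; simp
        · rw [Function.update_of_ne hjX, Function.update_of_ne hjX]
          exact h1 _ (Or.inr ⟨hj, Or.inr hjX⟩)
  have hdep : ∀ i v v', v i = v' i → (∀ j, E j i → v j = v' j) → h i v = h i v' := by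
    intro i v v' h1 h2
    refine hdep0 i v v' ?_
    rintro j (rfl | hj)
    exacts [h1, h2 j hj.1]
  have hnorm : ∀ i v, ∑ a, h i (Function.update v i a) = 1 := by
    intro i v
    simp only [hh]
    split_ifs with hi
    · subst hi; exact fnorm _ v
    · simp only [Function.update_comm hi]
      exact fnorm i _
  have hgq : ∀ v, v X = x X → g v = q v := by
    intro v hv
    rw [hqf]
    refine Finset.prod_congr rfl fun i _ => ?_
    simp only [hh]
    rw [← hv, Function.update_eq_self]
    split_ifs with hi
    · rw [hi]
    · rfl
  -- marginal of Z
  have hZmarg : ∀ w, prS q Z w = prS g Z w := by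
    intro w
    let N : Finset I := Finset.univ.filter fun i => ¬ Anc E X i
    have hN : ∀ i ∈ N, ∀ j, E j i → j ∈ N := by
      intro i hi j hj
      simp only [N, Finset.mem_filter, Finset.mem_univ, true_and] at hi ⊢
      exact fun h1 => hi (Relation.ReflTransGen.tail h1 hj)
    have hφ : ∀ v v', (∀ i ∈ N, v i = v' i) → matchInd Z w v = matchInd Z w v' := by
      intro v v' h1
      refine matchInd_congr (fun _ _ => rfl) fun i hi => h1 i ?_
      simp only [N, Finset.mem_filter, Finset.mem_univ, true_and]
      exact fun h2 => hZX ⟨i, hi, h2⟩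
    have m1 := marg E hdag f fdep fnorm N hN (matchInd Z w) hφ
    have m2 := marg E hdag h hdep hnorm N hN (matchInd Z w) hφ
    rw [prS_eq, prS_eq]
    refine mul_right_cancel₀ (card_prod_ne (α := α) Nᶜ) ?_
    simp only [hqf, hg]
    rw [m1, m2]
    refine Finset.sum_congr rfl fun v _ => ?_
    congr 1
    refine Finset.prod_congr rfl fun i hi => ?_
    simp only [N, Finset.mem_filter, Finset.mem_univ, true_and] at hi
    have hiX : i ≠ X := by rintro rfl; exact hi Relation.ReflTransGen.refl
    simp only [hh, if_neg hiX]
    refine fdep i _ _ (Function.update_of_ne hiX _ _).symm fun j hj => ?_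
    refine (Function.update_of_ne ?_ _ _).symm
    rintro rfl
    exact hi (Relation.ReflTransGen.single hj)
  -- conditional independence
  have hCI : ∀ w, prS g ({Y} ∪ ({X} ∪ Z)) w * prS g Z w
      = prS g ({Y} ∪ Z) w * prS g ({X} ∪ Z) w := by
    intro w
    let A : Finset I := Finset.univ.filter fun i => AnS E (Z ∪ {X}) i ∨ Anc E i Y
    have hmemA : ∀ i, i ∈ A ↔ (AnS E (Z ∪ {X}) i ∨ Anc E i Y) := by simp [A]
    have hA : ∀ i ∈ A, ∀ j, E j i → j ∈ A := by
      intro i hi j hj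
      rw [hmemA] at hi ⊢
      rcases hi with h1 | h1
      · exact Or.inl (h1.of_anc (Relation.ReflTransGen.single hj))
      · exact Or.inr (Relation.ReflTransGen.head hj h1)
    have hYA : Y ∈ A := (hmemA Y).2 (Or.inr Relation.ReflTransGen.refl)
    have hXA : X ∈ A := (hmemA X).2 (Or.inl ⟨X, Or.inr rfl, Relation.ReflTransGen.refl⟩)
    have hZA : ∀ i ∈ Z, i ∈ A := fun i hi =>
      (hmemA i).2 (Or.inl ⟨i, Or.inl hi, Relation.ReflTransGen.refl⟩)
    have mm : ∀ S : Set I, (∀ i ∈ S, i ∈ A) →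
        prS g S w * ∏ i ∈ Aᶜ, (Fintype.card (α i) : ℝ) = ∑ v, matchInd S w v * ∏ i ∈ A, h i v := by
      intro S hS
      rw [prS_eq]
      exact marg E hdag h hdep hnorm A hA (matchInd S w) fun v v' h1 =>
        matchInd_congr (fun _ _ => rfl) fun i hi => h1 i (hS i hi)
    have sw := swap_ci U Z X Y hXU hYU A h (fun i => {j | j = i ∨ (E j i ∧ (i = X ∨ j ≠ X))})
      (fun i _ => hdep0 i) (by
        intro i hi
        rw [hmemA] at hi
        by_cases hiX : i = X
        · left
          rintro j (rfl | ⟨hj, -⟩)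
          · rw [hiX]; exact Or.inl hXU
          · rw [hiX] at hj; exact hpaX j hj
        · rcases hfam i hi hiX with ⟨h1, h2⟩ | ⟨h1, h2⟩
          · left
            rintro j (rfl | ⟨hj, hjX⟩)
            · exact h1
            · exact h2 j (hjX.resolve_left hiX) hj
          · right
            rw [Set.disjoint_left]
            rintro j (rfl | ⟨hj, hjX⟩)
            · exact h1
            · exact h2 j (hjX.resolve_left hiX) hj) w
    rw [← mm _ (by rintro i (rfl | rfl | hi); exacts [hYA, hXA, hZA i hi]), ← mm _ hZA,
      ← mm _ (by rintro i (rfl | hi); exacts [hYA, hZA i hi]),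
      ← mm _ (by rintro i (rfl | hi); exacts [hXA, hZA i hi])] at sw
    have hc := card_prod_ne (α := α) Aᶜ
    refine mul_right_cancel₀ hc (mul_right_cancel₀ hc ?_)
    linear_combination sw
  -- left side
  have hL : (∑ᶠ v ∈ {v : ∀ i, α i | ∀ i ∈ ({Y} : Set I), v i = y i}, doPMF q E {X} x v)
      = ∑ v, matchInd {Y} y v * g v := by
    rw [show (∑ᶠ v ∈ {v : ∀ i, α i | ∀ i ∈ ({Y} : Set I), v i = y i}, doPMF q E {X} x v)
      = prS (doPMF q E {X} x) {Y} y from rfl, prS_eq, fiber_sum (fun v => matchInd {Y} y v * g v) X (x X)]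
    refine Finset.sum_congr rfl fun v _ => ?_
    have hd : doPMF q E {X} x v = if v X = x X then ∏ i ∈ Finset.univ.erase X, f i v else 0 := by
      unfold doPMF
      have : (∀ i ∈ ({X} : Set I), v i = x i) ↔ v X = x X := by simp
      simp only [this]
      congr 1
      rw [finprod_mem_eq_prod_of_inter_mulSupport_eq]
      ext i; simp
    rw [hd]
    split_ifs with hv
    · have e : ∀ a, matchInd {Y} y (Function.update v X a) * g (Function.update v X a)
          = (matchInd {Y} y v * ∏ i ∈ Finset.univ.erase X, f i v) * f X (Function.update v X a) := by
        intro a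
        have e1 : matchInd {Y} y (Function.update v X a) = matchInd {Y} y v := by
          rw [matchInd_single, matchInd_single, Function.update_of_ne hXY.symm]
        have e2 : g (Function.update v X a)
            = f X (Function.update v X a) * ∏ i ∈ Finset.univ.erase X, f i v := by
          simp only [hg]
          rw [← Finset.mul_prod_erase Finset.univ _ (Finset.mem_univ X)]
          congr 1
          · simp [hh]
          · refine Finset.prod_congr rfl fun i hi => ?_
            simp only [hh, if_neg (Finset.ne_of_mem_erase hi), Function.update_idem]
            rw [← hv, Function.update_eq_self]
        rw [e1, e2]; ring
      simp only [e, ← Finset.mul_sum, fnorm, mul_one]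
    · simp
  rw [hL, finsum_eq_sum_of_fintype]
  -- right side
  have hR : ∀ z : (∀ j : Z, α j.1),
      condPr q {Y} ({X} ∪ Z) (mergeVals {X} Z x z y) * prS q Z (mergeVals {X} Z x z y)
      = prS g ({Y} ∪ Z) (mergeVals {X} Z x z y) := by
    intro z
    set w := mergeVals {X} Z x z y with hw
    have hwX : w X = x X := by simp [hw, mergeVals, hXZ]
    have hqg : ∀ S : Set I, X ∈ S → prS q S w = prS g S w := by
      intro S hS
      rw [prS_eq, prS_eq]
      refine Finset.sum_congr rfl fun v _ => ?_
      unfold matchInd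
      split_ifs with h1
      · rw [hgq v ((h1 X hS).trans hwX)]
      · simp
    unfold condPr
    have hpos : 0 < prS q ({X} ∪ Z) w := prS_pos q hq _ _
    rw [hqg ({X} ∪ Z) (Or.inl rfl)] at hpos ⊢
    rw [hqg ({Y} ∪ ({X} ∪ Z)) (Or.inr (Or.inl rfl)), hZmarg, div_mul_eq_mul_div, hCI,
      mul_div_assoc, div_self hpos.ne', mul_one]
  rw [Finset.sum_congr rfl fun z _ => hR z]
  simp only [prS_eq]
  rw [Finset.sum_comm]
  refine Finset.sum_congr rfl fun v _ => ?_
  rw [← Finset.sum_mul]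
  congr 1
  have e : ∀ z : (∀ j : Z, α j.1), matchInd ({Y} ∪ Z) (mergeVals {X} Z x z y) v
      = matchInd {Y} y v * if z = (fun j : Z => v j.1) then 1 else 0 := by
    intro z
    rw [matchInd_union]
    congr 1
    · refine matchInd_congr ?_ fun _ _ => rfl
      rintro i rfl
      simp [mergeVals, hYZ, hXY.symm]
    · unfold matchInd
      have : (∀ i ∈ Z, v i = mergeVals {X} Z x z y i) ↔ z = (fun j : Z => v j.1) := by
        constructor
        · intro h1
          funext j
          have := h1 j.1 j.2
          simp only [mergeVals, j.2, dif_pos] at this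
          exact this.symm
        · rintro rfl i hi
          simp [mergeVals, hi]
      simp only [this]
  simp only [e, ← Finset.mul_sum]
  simp

/-- **R1 Entner.** Given a positive pmf `p` Markov compatible with and faithful to the
DAG `E`, if `W₀ ∈ W` and `Z ⊆ W \ {W₀}` with `W₀` and `Y` conditionally dependent given
`Z` and conditionally independent given `Z ∪ {X}`, then there is a directed path from
`X` to `Y` with at least one edge and `Z` is an adjustment set relative to
`({X}, {Y})`. -/
theorem stmt_1 (E : I → I → Prop)
    (hdag : Irreflexive (Relation.TransGen E))
    (p : (∀ i, α i) → ℝ) (hpmf : IsPMF p) (hpos : ∀ v, 0 < p v)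
    (hmarkov : MarkovCompat p E) (hfaith : Faithful p E)
    (X Y : I) (hXY : X ≠ Y)
    (W : Set I) (hW : W ⊆ ({X, Y} : Set I)ᶜ)
    (hordWX : ∀ w ∈ W, ¬ Anc E X w) (hordWY : ∀ w ∈ W, ¬ Anc E Y w)
    (hordXY : ¬ Anc E Y X)
    (W0 : I) (hW0 : W0 ∈ W)
    (Z : Set I) (hZ : Z ⊆ W \ {W0})
    (hdep : ¬ CondIndep p {W0} {Y} Z)
    (hindep : CondIndep p {W0} {Y} (Z ∪ {X})) :
    Relation.TransGen E X Y ∧ IsAdjustmentSet (α := α) E {X} {Y} Z := by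
  have hWX : ∀ w ∈ W, w ≠ X := by
    rintro w hw rfl; exact hW hw (Or.inl rfl)
  have hWY : ∀ w ∈ W, w ≠ Y := by
    rintro w hw rfl; exact hW hw (Or.inr rfl)
  have hXZ : X ∉ Z := fun h => hWX X (hZ h).1 rfl
  have hYZ : Y ∉ Z := fun h => hWY Y (hZ h).1 rfl
  have hW0Z : W0 ∉ Z := fun h => (hZ h).2 rfl
  have hW0X := hWX W0 hW0
  have hW0Y := hWY W0 hW0
  have hZX : ¬ AnS E Z X := by
    rintro ⟨d, hd, h⟩; exact hordWX d (hZ hd).1 h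
  have hdisj : Disjoint ({W0} : Set I) {Y} := by simpa using hW0Y
  have hconn : ¬ DSep E {W0} {Y} Z := by
    rwa [← hfaith {W0} {Y} Z hdisj (by
      rw [Set.disjoint_left]; rintro a ha (rfl | rfl); exacts [hW0Z ha, hYZ ha])]
  have hsep : DSep E {W0} {Y} (Z ∪ {X}) := by
    rwa [← hfaith {W0} {Y} (Z ∪ {X}) hdisj (by
      rw [Set.disjoint_left]
      rintro a (ha | ha) (rfl | rfl)
      exacts [hW0Z ha, hYZ ha, hW0X ha, hXY (Eq.symm ha)])]
  obtain ⟨h1, h2⟩ := graph_core hdag hXY (hordWX W0 hW0) hZX hW0Z hconn hsep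
  refine ⟨h1, ?_⟩
  obtain ⟨U, hXU, hYU, hpa, hfam⟩ := family_split hdag hXY hW0Y hW0Z hW0X hsep h2
  exact adjust E hdag X Y hXY Z hYZ hXZ hZX U hXU hYU hpa hfam
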